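/- Let m, p be positive integers, r ≥ m − 1 an integer, N ≥ 0, n = 2m. Work in the field of rational functions over ℚ in indeterminates a₁,…,a_n, y₁,…,y_N, x₁,…,x_n. Then m!·(m+1)! · Pf( (a_i − a_j) · s_{(r^p)}(y₁,…,y_N, x_i, x_j) ) = ( s_{((r+1)^{p−1})}(y₁,…,y_N) )^{m−1} · s_{((r−m+1)^{p+m−1})}(y₁,…,y_N, x₁,…,x_n) · ∑_{σ ∈ S_n} sgn(σ) · ∏_{i=1}^{m} (a_{σ(i)} − a_{σ(m+i)}) · Δ(x_{σ(1)},…,x_{σ(m)}) · Δ(x_{σ(m+1)},…,x_{σ(n)}), where Pf is the Pfaffian of the antisymmetric n × n matrix with (i,j) entry (a_i − a_j)·s_{(r^p)}(y, x_i, x_j). -/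

import Mathlib

open Finset

/-- The Pfaffian of a `2m × 2m` matrix: the sum over all permutations `σ` with
`σ(2i-1) < σ(2i)` for each `i` and `σ(1) < σ(3) < ⋯ < σ(2m-1)` (1-indexed). -/
def pfaffian {R : Type*} [CommRing R] (m : ℕ) (M : Matrix (Fin (2 * m)) (Fin (2 * m)) R) : R :=
  ∑ σ : Equiv.Perm (Fin (2 * m)),
    if (∀ i : Fin m, σ ⟨2 * i.val, by omega⟩ < σ ⟨2 * i.val + 1, by omega⟩) ∧
       (∀ i j : Fin m, i < j → σ ⟨2 * i.val, by omega⟩ < σ ⟨2 * j.val, by omega⟩)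
    then ((Equiv.Perm.sign σ : ℤ) : R) *
      ∏ i : Fin m, M (σ ⟨2 * i.val, by omega⟩) (σ ⟨2 * i.val + 1, by omega⟩)
    else 0

/-- The Schur polynomial for a weakly increasing index vector `μ` of length `p`,
as `det(tᵢ^{μⱼ + j - 1}) / det(tᵢ^{j-1})` (0-indexed: `det(tᵢ^{μⱼ + j}) / det(tᵢ^j)`). -/
noncomputable def schur {K : Type*} [Field K] {p : ℕ} (μ : Fin p → ℕ) (t : Fin p → K) : K :=
  Matrix.det (Matrix.of fun i j : Fin p => t i ^ (μ j + (j : ℕ))) /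
    Matrix.det (Matrix.of fun i j : Fin p => t i ^ (j : ℕ))

/-- Pad a partition `v₁ ≥ v₂ ≥ … ≥ v_l` with zeros to length `p ≥ l` and rearrange
weakly increasingly. -/
def padIncr (l p : ℕ) (v : Fin l → ℕ) : Fin p → ℕ :=
  fun j => if h : p - 1 - (j : ℕ) < l then v ⟨p - 1 - (j : ℕ), h⟩ else 0

/-- `Δ(t₁,…,t_p) = ∏_{i<j} (tᵢ - tⱼ)`. -/
noncomputable def vanderm {K : Type*} [Field K] {p : ℕ} (t : Fin p → K) : K :=
  ∏ i : Fin p, ∏ j : Fin p, if i < j then t i - t j else 1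

/-- The field of rational functions over `ℚ` in `a₁,…,a_n, y₁,…,y_N, x₁,…,x_n`. -/
abbrev RatFunc16 (N n : ℕ) : Type := FractionRing (MvPolynomial (Fin n ⊕ Fin N ⊕ Fin n) ℚ)

noncomputable def A16 (N n : ℕ) (i : Fin n) : RatFunc16 N n :=
  algebraMap (MvPolynomial (Fin n ⊕ Fin N ⊕ Fin n) ℚ) _ (MvPolynomial.X (Sum.inl i))

noncomputable def Y16 (N n : ℕ) (i : Fin N) : RatFunc16 N n :=
  algebraMap (MvPolynomial (Fin n ⊕ Fin N ⊕ Fin n) ℚ) _ (MvPolynomial.X (Sum.inr (Sum.inl i)))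

noncomputable def X16 (N n : ℕ) (i : Fin n) : RatFunc16 N n :=
  algebraMap (MvPolynomial (Fin n ⊕ Fin N ⊕ Fin n) ℚ) _ (MvPolynomial.X (Sum.inr (Sum.inr i)))

section PairedPermutations

open Equiv
open Equiv.Perm (sign)

variable {m : ℕ}

lemma sign_symm_trans {ι : Type*} [Fintype ι] {n : ℕ} (ψ χ : ι ≃ Fin n) :
    sign (ψ.symm.trans χ) =
      ∏ a, ∏ b, if ψ a < ψ b ∧ χ b < χ a then -1 else 1 := by
  rw [Perm.sign_eq_prod_prod_Ioi, ← ψ.prod_comp]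
  refine prod_congr rfl fun a _ => ?_
  rw [← ψ.symm.prod_comp, ← filter_lt_eq_Ioi, prod_filter]
  refine prod_congr rfl fun b _ => ?_
  have hne : ψ a < b → χ a ≠ χ (ψ.symm b) := fun h h' => by
    have := χ.injective h'
    rw [this, apply_symm_apply] at h
    exact h.false
  by_cases h : ψ a < b <;> simp [h]
  grind

/-- The involution of `Fin m ⊕ Fin m` exchanging the two copies of each `i ∈ U`. -/
def flipOn (U : Finset (Fin m)) : Perm (Fin m ⊕ Fin m) :=
  Function.Involutive.toPerm
    (Sum.elim (fun i => if i ∈ U then Sum.inr i else Sum.inl i)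
      (fun i => if i ∈ U then Sum.inl i else Sum.inr i))
    (by rintro (i | i) <;> by_cases h : i ∈ U <;> simp [h])

@[simp] lemma flipOn_inl (U : Finset (Fin m)) (i : Fin m) :
    flipOn U (Sum.inl i) = if i ∈ U then Sum.inr i else Sum.inl i := rfl

@[simp] lemma flipOn_inr (U : Finset (Fin m)) (i : Fin m) :
    flipOn U (Sum.inr i) = if i ∈ U then Sum.inl i else Sum.inr i := rfl

lemma sign_flipOn (U : Finset (Fin m)) : sign (flipOn U) = (-1) ^ #U := by
  induction U using Finset.induction_on with
  | empty =>
    have : flipOn (∅ : Finset (Fin m)) = 1 := by ext (i | i) <;> simp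
    simp [this]
  | insert a U ha ih =>
    have : flipOn (insert a U) = swap (Sum.inl a) (Sum.inr a) * flipOn U := by
      ext (i | i) <;> by_cases h : i = a <;> by_cases h' : i ∈ U <;>
        simp_all [swap_apply_def]
    rw [this, Perm.sign_mul, ih, Perm.sign_swap (by simp), card_insert_of_notMem ha, pow_succ']

/-- Every bijection onto a linear order has a unique rearrangement that is increasing within
each pair and has increasing first entries. -/
lemma existsUnique_sorted_pairs {α : Type*} [LinearOrder α] (s : Fin m ⊕ Fin m → α)
    (hs : Function.Injective s) :
    ∃! h : Finset (Fin m) × Perm (Fin m),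
      (∀ i, s (flipOn h.1 (Sum.inl (h.2 i))) < s (flipOn h.1 (Sum.inr (h.2 i)))) ∧
      ∀ i j, i < j → s (flipOn h.1 (Sum.inl (h.2 i))) < s (flipOn h.1 (Sum.inl (h.2 j))) := by
  set U : Finset (Fin m) := {i | s (Sum.inr i) < s (Sum.inl i)} with hU
  set w : Fin m → α := fun i => s (flipOn U (Sum.inl i)) with hw
  have hwinj : Function.Injective w := fun i j h => by
    simpa using (flipOn U).injective (hs h)
  refine ⟨(U, Tuple.sort w), ⟨fun i => ?_, fun i j hij => ?_⟩, ?_⟩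
  · have hne : s (Sum.inl (Tuple.sort w i)) ≠ s (Sum.inr (Tuple.sort w i)) :=
      fun h => by simpa using hs h
    by_cases h : Tuple.sort w i ∈ U
    · simpa [h] using (by simpa [hU] using h)
    · have h' := h
      simp only [hU, mem_filter, mem_univ, true_and, not_lt] at h'
      simpa [h] using lt_of_le_of_ne h' hne
  · refine lt_of_le_of_ne (Tuple.monotone_sort w hij.le) fun h => hij.ne ?_
    exact (Tuple.sort w).injective (hwinj h)
  · rintro ⟨U', τ⟩ ⟨h1, h2⟩
    have hUU : U' = U := by
      ext i
      have := h1 (τ.symm i)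
      simp only [apply_symm_apply, flipOn_inl, flipOn_inr] at this
      by_cases h : i ∈ U' <;> simp only [h, if_true, if_false] at this
      · simpa [h, hU] using this
      · simpa [h, hU] using this.le
    subst hUU
    have : StrictMono (w ∘ τ) := fun i j hij => h2 i j hij
    have := Tuple.unique_monotone this.monotone (Tuple.monotone_sort w)
    ext i
    · rfl
    · exact congrArg Fin.val (hwinj (congrFun this i))

/-- The permutation of `Fin m ⊕ Fin m` permuting pairs by `h.2` and flipping those in `h.1`. -/
def pairPerm (h : Finset (Fin m) × Perm (Fin m)) : Perm (Fin m ⊕ Fin m) :=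
  flipOn h.1 * Perm.sumCongr h.2 h.2

lemma sign_pairPerm (h : Finset (Fin m) × Perm (Fin m)) : sign (pairPerm h) = (-1) ^ #h.1 := by
  rw [pairPerm, Perm.sign_mul, sign_flipOn, Perm.sign_sumCongr, Int.units_mul_self, mul_one]

variable {R : Type*} [CommRing R]

/-- A Pfaffian-type sum over all permutations is `2 ^ m * m!` times the sum over the
representatives that are sorted within pairs and across pairs. -/
lemma sum_perm_pairs {n : ℕ} (e : Fin m ⊕ Fin m ≃ Fin n) (M : Matrix (Fin n) (Fin n) R)
    (hM : ∀ i j, M i j = -M j i) :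
    ∑ σ : Perm (Fin n), ((sign σ : ℤ) : R) *
        ∏ i, M (σ (e (Sum.inl i))) (σ (e (Sum.inr i))) =
      2 ^ m * (m.factorial : R) * ∑ σ : Perm (Fin n),
        if (∀ i, σ (e (Sum.inl i)) < σ (e (Sum.inr i))) ∧
          (∀ i j, i < j → σ (e (Sum.inl i)) < σ (e (Sum.inl j)))
        then ((sign σ : ℤ) : R) * ∏ i, M (σ (e (Sum.inl i))) (σ (e (Sum.inr i))) else 0 := by
  set F : Perm (Fin n) → R := fun σ => ((sign σ : ℤ) : R) *
        ∏ i, M (σ (e (Sum.inl i))) (σ (e (Sum.inr i))) with hF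
  set good : Perm (Fin n) → Prop := fun σ => (∀ i, σ (e (Sum.inl i)) < σ (e (Sum.inr i))) ∧
          (∀ i j, i < j → σ (e (Sum.inl i)) < σ (e (Sum.inl j))) with hgood
  set act : Finset (Fin m) × Perm (Fin m) → Perm (Fin n) := fun h => e.permCongr (pairPerm h)
  have hinv : ∀ σ h, F (σ * act h) = F σ := by
    intro σ h
    have hM' : ∀ i, M ((σ * act h) (e (Sum.inl i))) ((σ * act h) (e (Sum.inr i))) =
        (if h.2 i ∈ h.1 then -1 else 1) *
          M (σ (e (Sum.inl (h.2 i)))) (σ (e (Sum.inr (h.2 i)))) := by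
      intro i
      by_cases hi : h.2 i ∈ h.1 <;> simp [act, pairPerm, hi]
      exact hM _ _
    have hp : ∏ i, (if i ∈ h.1 then (-1 : R) else 1) = (-1) ^ #h.1 := by
      simp
    simp only [hF, hM', prod_mul_distrib]
    rw [Equiv.prod_comp h.2 (fun i => if i ∈ h.1 then (-1 : R) else 1), hp,
      Equiv.prod_comp h.2 (fun i => M (σ (e (Sum.inl i))) (σ (e (Sum.inr i))))]
    have : sign (act h) = (-1) ^ #h.1 := by rw [Perm.sign_permCongr, sign_pairPerm]
    rw [Perm.sign_mul, this]
    push_cast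
    have h1 : ((-1 : R) ^ #h.1) * (-1) ^ #h.1 = 1 := by rw [← mul_pow]; simp
    linear_combination ((sign σ : ℤ) : R) *
      (∏ i, M (σ (e (Sum.inl i))) (σ (e (Sum.inr i)))) * h1
  have huniq : ∀ σ, ∃! h, good (σ * act h) := by
    intro σ
    have := existsUnique_sorted_pairs (fun a => σ (e a)) (σ.injective.comp e.injective)
    simpa [hgood, act, pairPerm] using this
  classical
  calc ∑ σ, F σ = ∑ σ, ∑ h, if good (σ * act h) then F (σ * act h) else 0 := by
        refine sum_congr rfl fun σ _ => ?_
        obtain ⟨h, hh, hu⟩ := huniq σ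
        rw [sum_eq_single h (fun b _ hb => if_neg fun h' => hb (hu b h')) (by simp),
          if_pos hh, hinv]
    _ = ∑ h : Finset (Fin m) × Perm (Fin m), ∑ σ, if good σ then F σ else 0 := by
        rw [sum_comm]
        exact sum_congr rfl fun h _ =>
          Equiv.sum_comp (Equiv.mulRight (act h)) (fun σ => if good σ then F σ else 0)
    _ = _ := by
        simp only [sum_const, card_univ, Fintype.card_prod, Fintype.card_finset, Fintype.card_fin,
          Fintype.card_perm, nsmul_eq_mul]
        push_cast
        congr 1

end PairedPermutations

section Bialternants

open Equiv
open Equiv.Perm (sign)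
open Matrix (vandermonde)

variable {m : ℕ} {R : Type*} [CommRing R]

/-- The number of permutations preserving a subset. -/
lemma card_perm_preserving (U : Finset (Fin m)) :
    #{δ : Perm (Fin m) | ∀ i, i ∈ U ↔ δ i ∈ U} = (#U).factorial * (m - #U).factorial := by
  have h := DomMulAct.stabilizer_card (fun i : Fin m => decide (i ∈ U))
  rw [Fintype.card_subtype] at h
  have h1 : Fintype.card {a // a ∈ U} = #U := by simp
  have h2 : Fintype.card {a // a ∉ U} = m - #U := by simp [Fintype.card_subtype_compl]
  simp only [Fintype.prod_bool, decide_eq_true_eq, decide_eq_false_iff_not, h1, h2] at h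
  rw [← h]
  congr 1
  ext δ
  simp [funext_iff, eq_comm]

lemma det_submatrix_mixed (Q : Matrix (Fin m ⊕ Fin m) (Fin m ⊕ Fin m) R) (U : Finset (Fin m))
    (π δ : Perm (Fin m)) :
    (Q.submatrix id (Sum.map (fun i => π (if i ∈ U then δ i else i))
      (fun i => π (if i ∈ U then i else δ i)))).det =
      if ∀ i, i ∈ U ↔ δ i ∈ U then ((sign δ : ℤ) : R) * Q.det else 0 := by
  split_ifs with h
  · set γ : Perm (Fin m) := Perm.ofSubtype (δ.subtypePerm (p := (· ∈ U)) fun i => (h i).symm)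
      with hγ
    have h1 : ∀ i, γ i = if i ∈ U then δ i else i := by
      intro i
      split_ifs with hi
      · rw [hγ, Perm.ofSubtype_apply_of_mem _ hi]; rfl
      · rw [hγ, Perm.ofSubtype_apply_of_not_mem _ hi]
    have h2 : ∀ i, (γ⁻¹ * δ) i = if i ∈ U then i else δ i := by
      intro i
      rw [Perm.mul_apply, Perm.inv_eq_iff_eq, h1]
      by_cases hi : i ∈ U
      · simp [hi]
      · simp [hi, mt (h i).2 hi]
    have : Sum.map (fun i => π (if i ∈ U then δ i else i))
        (fun i => π (if i ∈ U then i else δ i)) =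
        (Perm.sumCongr (π * γ) (π * (γ⁻¹ * δ)) : Perm (Fin m ⊕ Fin m)) := by
      ext (i | i) <;> simp [← h1, ← h2]
    rw [this, Matrix.det_permute']
    have hs : sign (π * γ) * sign (π * (γ⁻¹ * δ)) = sign δ := by
      simp only [Perm.sign_mul, Perm.sign_inv]
      calc _ = (sign π * sign π) * (sign γ * sign γ) * sign δ := by
            simp only [mul_assoc, mul_left_comm]
        _ = _ := by simp
    rw [Perm.sign_sumCongr, hs]
  · have : ∃ i, ¬(i ∈ U ↔ δ i ∈ U) := by simpa using h
    obtain ⟨i, hi⟩ := this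
    by_cases hU : i ∈ U
    · have hδ : δ i ∉ U := fun h' => hi (iff_of_true hU h')
      refine Matrix.det_zero_of_column_eq (i := Sum.inl i) (j := Sum.inl (δ i)) ?_ ?_
      · intro he
        exact hδ (Sum.inl_injective he ▸ hU)
      · simp [hU, hδ]
    · have hδ : δ i ∈ U := by tauto
      refine Matrix.det_zero_of_column_eq (i := Sum.inr i) (j := Sum.inr (δ i)) ?_ ?_
      · intro he
        exact hU (Sum.inr_injective he ▸ hδ)
      · simp [hU, hδ]

/-- The alternant with columns `f k * x k ^ j` followed by `g k * x k ^ j`, for `j < m`. -/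
def bialternant {ι : Type*} (f g x : ι → R) : Matrix ι (Fin m ⊕ Fin m) R :=
  Matrix.of fun k => Sum.elim (fun j => f k * x k ^ (j : ℕ)) (fun j => g k * x k ^ (j : ℕ))

lemma det_bialternant_comp (f g x : Fin m ⊕ Fin m → R) (ρ : Perm (Fin m ⊕ Fin m)) :
    (bialternant (f ∘ ρ) (g ∘ ρ) (x ∘ ρ)).det =
      ((sign ρ : ℤ) : R) * (bialternant f g x).det :=
  Matrix.det_permute ρ (bialternant f g x)

lemma det_vandermonde_eq_sum (u : Fin m → R) :
    (vandermonde u).det = ∑ π : Perm (Fin m), ((sign π : ℤ) : R) * ∏ i, u i ^ (π i : ℕ) := by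
  rw [← Matrix.det_transpose, Matrix.det_apply']
  rfl

lemma sum_perm_prod_vandermonde (a x : Fin m ⊕ Fin m → R) (U : Finset (Fin m)) :
    ∑ ρ : Perm (Fin m ⊕ Fin m), ((sign ρ : ℤ) : R) *
        ((∏ i, a (ρ (flipOn U (Sum.inl i)))) * (vandermonde fun i => x (ρ (Sum.inl i))).det *
          (vandermonde fun i => x (ρ (Sum.inr i))).det) =
      (-1) ^ #U * ((m.factorial * ((#U).factorial * (m - #U).factorial) : ℕ) : R) *
        (bialternant a 1 x).det := by
  have key : ∀ π δ : Perm (Fin m), ∑ ρ : Perm (Fin m ⊕ Fin m), ((sign ρ : ℤ) : R) *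
      ∏ i, (a (ρ (Sum.inl i)) * (x (ρ (flipOn U (Sum.inl i))) ^ (π i : ℕ) *
        x (ρ (flipOn U (Sum.inr i))) ^ ((π * δ) i : ℕ))) =
      if ∀ i, i ∈ U ↔ δ i ∈ U then ((sign δ : ℤ) : R) * (bialternant a 1 x).det else 0 := by
    intro π δ
    rw [← det_submatrix_mixed, Matrix.det_apply']
    refine sum_congr rfl fun ρ _ => ?_
    rw [Fintype.prod_sum_type, ← prod_mul_distrib]
    congr 1
    refine prod_congr rfl fun i _ => ?_
    by_cases hi : i ∈ U <;> simp [hi, bialternant] <;> ring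
  have hδ : ∑ δ : Perm (Fin m), (if ∀ i, i ∈ U ↔ δ i ∈ U then (1 : R) else 0) =
      (((#U).factorial * (m - #U).factorial : ℕ) : R) := by
    rw [← card_perm_preserving]
    simp
  rw [← Equiv.sum_comp (Equiv.mulRight (flipOn U))]
  have hflip : ∀ c, flipOn U (flipOn U c) = c := by
    rintro (i | i) <;> by_cases hi : i ∈ U <;> simp [hi]
  calc _ = ∑ ρ : Perm (Fin m ⊕ Fin m), ∑ π : Perm (Fin m), ∑ δ : Perm (Fin m),
        (-1) ^ #U * ((sign δ : ℤ) : R) * (((sign ρ : ℤ) : R) *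
          ∏ i, (a (ρ (Sum.inl i)) * (x (ρ (flipOn U (Sum.inl i))) ^ (π i : ℕ) *
            x (ρ (flipOn U (Sum.inr i))) ^ ((π * δ) i : ℕ)))) := by
        refine sum_congr rfl fun ρ _ => ?_
        simp only [Equiv.coe_mulRight, Perm.mul_apply, hflip, Perm.sign_mul, sign_flipOn]
        rw [det_vandermonde_eq_sum, det_vandermonde_eq_sum, mul_assoc, sum_mul_sum, mul_sum,
          mul_sum]
        refine sum_congr rfl fun π _ => ?_
        rw [← Equiv.sum_comp (Equiv.mulLeft π), mul_sum, mul_sum]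
        refine sum_congr rfl fun δ _ => ?_
        have hπ : ((sign π : ℤ) : R) * ((sign π : ℤ) : R) = 1 := by
          rw [← Int.cast_mul, ← Units.val_mul, Int.units_mul_self]; simp
        simp only [Equiv.coe_mulLeft, Perm.mul_apply, Perm.sign_mul, prod_mul_distrib]
        push_cast
        linear_combination (((sign ρ : ℤ) : R) * (-1) ^ #U * (∏ i, a (ρ (Sum.inl i))) *
          ((sign δ : ℤ) : R) * (∏ i, x (ρ (flipOn U (Sum.inl i))) ^ (π i : ℕ)) *
          ∏ i, x (ρ (flipOn U (Sum.inr i))) ^ (π (δ i) : ℕ)) * hπ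
    _ = ∑ π : Perm (Fin m), ∑ δ : Perm (Fin m), (-1) ^ #U * ((sign δ : ℤ) : R) *
          if ∀ i, i ∈ U ↔ δ i ∈ U then ((sign δ : ℤ) : R) * (bialternant a 1 x).det else 0 := by
        rw [sum_comm]
        refine sum_congr rfl fun π _ => ?_
        rw [sum_comm]
        refine sum_congr rfl fun δ _ => ?_
        rw [← key π δ, mul_sum]
    _ = ∑ π : Perm (Fin m), ∑ δ : Perm (Fin m), (-1) ^ #U * (bialternant a 1 x).det *
          if ∀ i, i ∈ U ↔ δ i ∈ U then 1 else 0 := by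
        refine sum_congr rfl fun π _ => sum_congr rfl fun δ _ => ?_
        have hs : ((sign δ : ℤ) : R) * ((sign δ : ℤ) : R) = 1 := by
          rw [← Int.cast_mul, ← Units.val_mul, Int.units_mul_self]; simp
        split_ifs
        · linear_combination (-1) ^ #U * (bialternant a 1 x).det * hs
        · simp
    _ = _ := by
        simp only [← mul_sum, hδ, sum_const, card_univ, Fintype.card_perm, Fintype.card_fin,
          nsmul_eq_mul]
        push_cast
        ring

/-- The antisymmetrised product of differences against two Vandermonde determinants. -/
lemma sum_perm_prod_sub_vandermonde (a x : Fin m ⊕ Fin m → R) :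
    ∑ ρ : Perm (Fin m ⊕ Fin m), ((sign ρ : ℤ) : R) *
        ((∏ i, (a (ρ (Sum.inl i)) - a (ρ (Sum.inr i)))) *
          (vandermonde fun i => x (ρ (Sum.inl i))).det *
          (vandermonde fun i => x (ρ (Sum.inr i))).det) =
      ((m.factorial * (m + 1).factorial : ℕ) : R) * (bialternant a 1 x).det := by
  have hprod : ∀ ρ : Perm (Fin m ⊕ Fin m), ∏ i, (a (ρ (Sum.inl i)) - a (ρ (Sum.inr i))) =
      ∑ U : Finset (Fin m), (-1) ^ #U * ∏ i, a (ρ (flipOn U (Sum.inl i))) := by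
    intro ρ
    have h1 : ∀ i, a (ρ (Sum.inl i)) - a (ρ (Sum.inr i)) =
        -a (ρ (Sum.inr i)) + a (ρ (Sum.inl i)) := fun i => by ring
    simp only [h1, prod_add, powerset_univ]
    refine sum_congr rfl fun U _ => ?_
    rw [prod_neg, mul_assoc, ← compl_eq_univ_sdiff, ← prod_mul_prod_compl U]
    congr 2
    · exact prod_congr rfl fun i hi => by simp [hi]
    · exact prod_congr rfl fun i hi => by simp [mem_compl.1 hi]
  calc _ = ∑ U : Finset (Fin m), (-1) ^ #U * ∑ ρ : Perm (Fin m ⊕ Fin m), ((sign ρ : ℤ) : R) *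
        ((∏ i, a (ρ (flipOn U (Sum.inl i)))) * (vandermonde fun i => x (ρ (Sum.inl i))).det *
          (vandermonde fun i => x (ρ (Sum.inr i))).det) := by
        simp only [hprod, sum_mul, mul_sum]
        rw [sum_comm]
        exact sum_congr rfl fun U _ => sum_congr rfl fun ρ _ => by ring
    _ = ∑ U : Finset (Fin m), ((m.factorial * ((#U).factorial * (m - #U).factorial) : ℕ) : R) *
        (bialternant a 1 x).det := by
        refine sum_congr rfl fun U _ => ?_
        rw [sum_perm_prod_vandermonde]
        have h1 : ((-1 : R) ^ #U) * (-1) ^ #U = 1 := by rw [← mul_pow]; simp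
        linear_combination ((m.factorial * ((#U).factorial * (m - #U).factorial) : ℕ) : R) *
          (bialternant a 1 x).det * h1
    _ = _ := by
        rw [← sum_mul, ← Nat.cast_sum, ← mul_sum]
        congr 3
        rw [← powerset_univ,
          sum_powerset_apply_card (fun k => k.factorial * (m - k).factorial), card_univ,
          Fintype.card_fin]
        rw [sum_congr rfl (g := fun _ => m.factorial)]
        · simp [Nat.factorial_succ]
        · intro k hk
          rw [smul_eq_mul, ← mul_assoc]
          exact Nat.choose_mul_factorial_mul_factorial (by simpa [Nat.lt_succ_iff] using hk)

end Bialternants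

section CauchyDeterminant

open Matrix (vandermonde)

variable {m : ℕ} {K : Type*} [Field K]

lemma det_fromBlocks_of_commute {n R : Type*} [Fintype n] [DecidableEq n] [CommRing R]
    (A B C D : Matrix n n R) (h : A * B = B * A) :
    (Matrix.fromBlocks A B C D).det = (D * A - C * B).det := by
  set φ : Matrix n n R →+* Matrix n n (Polynomial R) := Polynomial.C.mapMatrix with hφ
  set A' : Matrix n n (Polynomial R) := Matrix.scalar n Polynomial.X + φ A with hA'
  have hcomm : A' * φ B = φ B * A' := by
    rw [hA', add_mul, mul_add, ← map_mul, h, map_mul,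
      (Matrix.scalar_commute (Polynomial.X : Polynomial R) (Commute.all _) (φ B)).eq]
  have hmul : Matrix.fromBlocks A' (φ B) (φ C) (φ D) * Matrix.fromBlocks 1 (-φ B) 0 A' =
      Matrix.fromBlocks A' 0 (φ C) (φ D * A' - φ C * φ B) := by
    rw [Matrix.fromBlocks_multiply]
    congr 1
    · simp
    · simp [hcomm]
    · simp
    · simp [sub_eq_neg_add]
  have hreg : A'.det ∈ nonZeroDivisors (Polynomial R) := by
    have h1 : A' = (-A).charmatrix := by
      ext i j
      simp [hA', hφ, Matrix.charmatrix]
    rw [h1]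
    exact (Matrix.charpoly_monic (-A)).mem_nonZeroDivisors
  have hdet : (Matrix.fromBlocks A' (φ B) (φ C) (φ D)).det = (φ D * A' - φ C * φ B).det := by
    have := congrArg Matrix.det hmul
    rw [Matrix.det_mul, Matrix.det_fromBlocks_zero₂₁, Matrix.det_fromBlocks_zero₁₂, Matrix.det_one,
      one_mul, mul_comm] at this
    exact (mul_cancel_left_mem_nonZeroDivisors hreg).1 this
  have heval := congrArg (Polynomial.evalRingHom (0 : R)) hdet
  have hE : ∀ M : Matrix n n R, (Polynomial.evalRingHom (0 : R)).mapMatrix (φ M) = M := by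
    intro M; ext i j; simp [hφ]
  have hEA : (Polynomial.evalRingHom (0 : R)).mapMatrix A' = A := by
    rw [hA', map_add, hE]; ext i j; simp
  rw [RingHom.map_det, RingHom.map_det, map_sub, map_mul, map_mul, hE, hE, hE, hEA] at heval
  rw [← heval]
  congr 1
  rw [RingHom.mapMatrix_apply, Matrix.fromBlocks_map]
  simp only [← RingHom.mapMatrix_apply, hE, hEA]

lemma prod_erase_sub_eq_det_vandermonde_sq {R : Type*} [CommRing R] (u : Fin m → R) :
    ∏ i, ∏ j ∈ univ.erase i, (u i - u j) =
      (∏ i : Fin m, ∏ _j ∈ Ioi i, (-1 : R)) * (vandermonde u).det ^ 2 := by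
  have h : ∀ i : Fin m, ∏ j ∈ univ.erase i, (u i - u j) =
      (∏ j ∈ Ioi i, (u i - u j)) * ∏ j ∈ Iio i, (u i - u j) := by
    intro i
    rw [← prod_union (by
      rw [disjoint_left]; intro j; simp only [mem_Ioi, mem_Iio]; exact fun h h' => h.not_gt h')]
    congr 1
    ext j
    simp [lt_or_lt_iff_ne, eq_comm]
  have h2 : ∏ i : Fin m, ∏ j ∈ Iio i, (u i - u j) = ∏ i : Fin m, ∏ j ∈ Ioi i, (u j - u i) :=
    prod_comm' (by simp)
  rw [prod_congr rfl fun i _ => h i, prod_mul_distrib, h2, Matrix.det_vandermonde, sq, ← mul_assoc]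
  congr 1
  rw [← prod_mul_distrib]
  refine prod_congr rfl fun i _ => ?_
  rw [← prod_mul_distrib]
  exact prod_congr rfl fun j _ => by ring

/-- A Cauchy-type evaluation of the determinant of a divided-difference matrix. -/
lemma det_divided_difference (f g x : Fin m ⊕ Fin m → K) (hx : Function.Injective x)
    (S : Matrix (Fin m) (Fin m) K)
    (hS : ∀ i j, S i j * (x (Sum.inr j) - x (Sum.inl i)) =
      f (Sum.inl i) * g (Sum.inr j) - g (Sum.inl i) * f (Sum.inr j)) :
    (bialternant f g x).det = (∏ i : Fin m, ∏ _j ∈ Ioi i, (-1 : K)) *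
      (∏ i, ∏ j, (x (Sum.inr j) - x (Sum.inl i))) * S.det := by
  set u : Fin m → K := fun i => x (Sum.inl i) with hu
  set v : Fin m → K := fun i => x (Sum.inr i) with hv
  have hui : Function.Injective u := hx.comp Sum.inl_injective
  set C : Matrix (Fin m) (Fin m) K :=
    Matrix.of fun j i => (Lagrange.basis univ u i).eval (v j) with hC
  have hCV : C * vandermonde u = vandermonde v := by
    ext j k
    have h1 := Lagrange.eq_interpolate (s := univ) (v := u)
      (f := (Polynomial.X : Polynomial K) ^ (k : ℕ))
      hui.injOn (by rw [Polynomial.degree_X_pow]; simp)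
    have h2 := congrArg (Polynomial.eval (v j)) h1
    rw [Lagrange.interpolate_apply, Polynomial.eval_finsetSum] at h2
    simp only [Polynomial.eval_pow, Polynomial.eval_X, Polynomial.eval_mul,
      Polynomial.eval_C] at h2
    rw [Matrix.mul_apply, Matrix.vandermonde_apply, h2]
    exact sum_congr rfl fun i _ => by simp [hC, Matrix.vandermonde_apply, mul_comm]
  set d : Fin m → K := fun i => ∏ j ∈ univ.erase i, (u i - u j) with hd
  have hd0 : ∀ i, d i ≠ 0 := fun i => prod_ne_zero_iff.2 fun j hj =>
    sub_ne_zero.2 fun h => (ne_of_mem_erase hj) (hui h).symm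
  have hCd : ∀ j i, C j i * (v j - u i) = (∏ k, (v j - u k)) * (d i)⁻¹ := by
    intro j i
    rw [← mul_prod_erase univ _ (mem_univ i), hC, Matrix.of_apply, Lagrange.basis,
      Polynomial.eval_prod]
    simp only [Lagrange.basisDivisor, Polynomial.eval_mul, Polynomial.eval_C, Polynomial.eval_sub,
      Polynomial.eval_X, prod_mul_distrib, hd, prod_inv_distrib]
    ring
  have hblock : (bialternant f g x).det = (vandermonde u).det ^ 2 *
      (Matrix.diagonal (fun j => g (Sum.inr j)) * C * Matrix.diagonal (fun i => f (Sum.inl i)) -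
        Matrix.diagonal (fun j => f (Sum.inr j)) * C *
          Matrix.diagonal (fun i => g (Sum.inl i))).det := by
    have : bialternant f g x = Matrix.fromBlocks (Matrix.diagonal (fun i => f (Sum.inl i)))
        (Matrix.diagonal (fun i => g (Sum.inl i))) (Matrix.diagonal (fun j => f (Sum.inr j)) * C)
        (Matrix.diagonal (fun j => g (Sum.inr j)) * C) *
        Matrix.fromBlocks (vandermonde u) 0 0 (vandermonde u) := by
      rw [Matrix.fromBlocks_multiply]
      simp only [Matrix.mul_assoc, Matrix.mul_zero, add_zero, zero_add, hCV]
      ext (i | i) (j | j) <;>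
        simp [bialternant, Matrix.diagonal_mul, Matrix.vandermonde_apply, hu, hv]
    rw [this, Matrix.det_mul, Matrix.det_fromBlocks_zero₂₁, det_fromBlocks_of_commute _ _ _ _
      (by rw [Matrix.diagonal_mul_diagonal, Matrix.diagonal_mul_diagonal]; simp only [mul_comm])]
    ring
  have hentry : (Matrix.diagonal (fun j => g (Sum.inr j)) * C *
        Matrix.diagonal (fun i => f (Sum.inl i)) -
        Matrix.diagonal (fun j => f (Sum.inr j)) * C *
          Matrix.diagonal (fun i => g (Sum.inl i))) =
      Matrix.diagonal (fun j => ∏ k, (v j - u k)) * S.transpose *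
        Matrix.diagonal (fun i => (d i)⁻¹) := by
    ext j i
    simp only [Matrix.sub_apply, Matrix.mul_diagonal, Matrix.diagonal_mul, Matrix.transpose_apply]
    linear_combination S i j * hCd j i - C j i * hS i j
  rw [hblock, hentry, Matrix.det_mul, Matrix.det_mul, Matrix.det_diagonal, Matrix.det_diagonal,
    Matrix.det_transpose, prod_inv_distrib, prod_comm]
  have hsq := prod_erase_sub_eq_det_vandermonde_sq u
  have hdp : ∏ i, d i ≠ 0 := prod_ne_zero_iff.2 fun i _ => hd0 i
  have hη : (∏ i : Fin m, ∏ _j ∈ Ioi i, (-1 : K)) * (∏ i : Fin m, ∏ _j ∈ Ioi i, (-1 : K)) = 1 := by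
    simp only [← prod_mul_distrib]; simp
  field_simp
  rw [hd, hsq]
  linear_combination -(vandermonde u).det ^ 2 * (∏ i, ∏ j, (v j - u i)) * S.det * hη

end CauchyDeterminant

section CorePfaffian

open Equiv
open Equiv.Perm (sign)
open Matrix (vandermonde)

variable {m : ℕ} {K : Type*} [Field K]

lemma sum_perm_prod_sub_mul_symm (a : Fin m ⊕ Fin m → K)
    (S : Matrix (Fin m ⊕ Fin m) (Fin m ⊕ Fin m) K) (hS : ∀ i j, i ≠ j → S i j = S j i) :
    ∑ ρ : Perm (Fin m ⊕ Fin m), ((sign ρ : ℤ) : K) *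
        ∏ i, ((a (ρ (Sum.inl i)) - a (ρ (Sum.inr i))) * S (ρ (Sum.inl i)) (ρ (Sum.inr i))) =
      2 ^ m * ∑ ρ : Perm (Fin m ⊕ Fin m), ((sign ρ : ℤ) : K) *
        ∏ i, (a (ρ (Sum.inl i)) * S (ρ (Sum.inl i)) (ρ (Sum.inr i))) := by
  have hprod : ∀ ρ : Perm (Fin m ⊕ Fin m),
      ∏ i, ((a (ρ (Sum.inl i)) - a (ρ (Sum.inr i))) * S (ρ (Sum.inl i)) (ρ (Sum.inr i))) =
      ∑ U : Finset (Fin m), (-1) ^ #U * ∏ i, (a (ρ (flipOn U (Sum.inl i))) *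
        S (ρ (flipOn U (Sum.inl i))) (ρ (flipOn U (Sum.inr i)))) := by
    intro ρ
    have h1 : ∀ i, (a (ρ (Sum.inl i)) - a (ρ (Sum.inr i))) *
        S (ρ (Sum.inl i)) (ρ (Sum.inr i)) =
        -(a (ρ (Sum.inr i)) * S (ρ (Sum.inr i)) (ρ (Sum.inl i))) +
          a (ρ (Sum.inl i)) * S (ρ (Sum.inl i)) (ρ (Sum.inr i)) := fun i => by
      rw [hS (ρ (Sum.inr i)) _ (by simp)]; ring
    simp only [h1, prod_add, powerset_univ]
    refine sum_congr rfl fun U _ => ?_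
    rw [prod_neg, mul_assoc, ← compl_eq_univ_sdiff, ← prod_mul_prod_compl U]
    congr 2
    · exact prod_congr rfl fun i hi => by simp [hi]
    · exact prod_congr rfl fun i hi => by simp [mem_compl.1 hi]
  simp only [hprod, mul_sum]
  rw [sum_comm]
  have hU : ∀ U : Finset (Fin m), ∑ ρ : Perm (Fin m ⊕ Fin m), ((sign ρ : ℤ) : K) * ((-1) ^ #U *
      ∏ i, (a (ρ (flipOn U (Sum.inl i))) *
        S (ρ (flipOn U (Sum.inl i))) (ρ (flipOn U (Sum.inr i))))) =
      ∑ ρ : Perm (Fin m ⊕ Fin m), ((sign ρ : ℤ) : K) *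
        ∏ i, (a (ρ (Sum.inl i)) * S (ρ (Sum.inl i)) (ρ (Sum.inr i))) := by
    intro U
    rw [← Equiv.sum_comp (Equiv.mulRight (flipOn U)) (fun ρ => ((sign ρ : ℤ) : K) *
        ∏ i, (a (ρ (Sum.inl i)) * S (ρ (Sum.inl i)) (ρ (Sum.inr i))))]
    refine sum_congr rfl fun ρ _ => ?_
    simp only [Equiv.coe_mulRight, Perm.mul_apply, Perm.sign_mul, sign_flipOn]
    push_cast
    ring
  rw [sum_congr rfl fun U _ => hU U, sum_const, nsmul_eq_mul, mul_sum]
  simp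

lemma sum_perm_prod_mul_det (a : Fin m ⊕ Fin m → K)
    (S : Matrix (Fin m ⊕ Fin m) (Fin m ⊕ Fin m) K) :
    ∑ ρ : Perm (Fin m ⊕ Fin m), ((sign ρ : ℤ) : K) * ((∏ i, a (ρ (Sum.inl i))) *
        (Matrix.of fun i j => S (ρ (Sum.inl i)) (ρ (Sum.inr j))).det) =
      m.factorial * ∑ ρ : Perm (Fin m ⊕ Fin m), ((sign ρ : ℤ) : K) *
        ∏ i, (a (ρ (Sum.inl i)) * S (ρ (Sum.inl i)) (ρ (Sum.inr i))) := by
  have hdet : ∀ ρ : Perm (Fin m ⊕ Fin m),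
      (Matrix.of fun i j => S (ρ (Sum.inl i)) (ρ (Sum.inr j))).det =
      ∑ τ : Perm (Fin m), ((sign τ : ℤ) : K) *
        ∏ i, S (ρ (Sum.inl i)) (ρ (Sum.inr (τ i))) := by
    intro ρ
    rw [← Matrix.det_transpose, Matrix.det_apply']
    rfl
  simp only [hdet, mul_sum]
  rw [sum_comm]
  have hτ : ∀ τ : Perm (Fin m), ∑ ρ : Perm (Fin m ⊕ Fin m), ((sign ρ : ℤ) : K) *
      ((∏ i, a (ρ (Sum.inl i))) * (((sign τ : ℤ) : K) *
        ∏ i, S (ρ (Sum.inl i)) (ρ (Sum.inr (τ i))))) =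
      ∑ ρ : Perm (Fin m ⊕ Fin m), ((sign ρ : ℤ) : K) *
        ∏ i, (a (ρ (Sum.inl i)) * S (ρ (Sum.inl i)) (ρ (Sum.inr i))) := by
    intro τ
    rw [← Equiv.sum_comp (Equiv.mulRight (Perm.sumCongr 1 τ)) (fun ρ => ((sign ρ : ℤ) : K) *
        ∏ i, (a (ρ (Sum.inl i)) * S (ρ (Sum.inl i)) (ρ (Sum.inr i))))]
    refine sum_congr rfl fun ρ _ => ?_
    simp only [Equiv.coe_mulRight, Perm.mul_apply, Perm.sign_mul, Perm.sign_sumCongr,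
      Perm.sign_one, one_mul, prod_mul_distrib, Perm.sumCongr_apply, Sum.map_inl, Sum.map_inr,
      Perm.one_apply]
    push_cast
    ring
  rw [sum_congr rfl fun τ _ => hτ τ, sum_const, nsmul_eq_mul, mul_sum, card_univ,
    Fintype.card_perm, Fintype.card_fin]

/-- The Vandermonde product of the concatenation of the two parts of `x`. -/
def splitVandermonde {R : Type*} [CommRing R] {k l : ℕ} (x : Fin k ⊕ Fin l → R) : R :=
  (vandermonde fun i => x (Sum.inl i)).det * (vandermonde fun i => x (Sum.inr i)).det *
    ∏ i, ∏ j, (x (Sum.inr j) - x (Sum.inl i))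

lemma det_pow_finSumFinEquiv {R : Type*} [CommRing R] {k l : ℕ} (x : Fin k ⊕ Fin l → R) :
    (Matrix.of fun a b => x a ^ (finSumFinEquiv b : ℕ)).det = splitVandermonde x := by
  have h : (Matrix.of fun a b => x a ^ (finSumFinEquiv b : ℕ)) =
      (vandermonde (x ∘ finSumFinEquiv.symm)).submatrix finSumFinEquiv finSumFinEquiv := by
    ext a b; simp [Matrix.vandermonde_apply]
  have hI : ∀ {n : ℕ} (F : Fin n → Fin n → R), ∏ i, ∏ j ∈ Ioi i, F i j =
      ∏ i, ∏ j, if i < j then F i j else 1 := by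
    intro n F
    simp_rw [← filter_lt_eq_Ioi, prod_filter]
  rw [h, Matrix.det_submatrix_equiv_self, splitVandermonde, Matrix.det_vandermonde,
    Matrix.det_vandermonde, Matrix.det_vandermonde, hI, hI, hI, ← finSumFinEquiv.prod_comp,
    Fintype.prod_sum_type]
  simp_rw [← finSumFinEquiv.prod_comp, Fintype.prod_sum_type, prod_mul_distrib]
  have h1 : ∀ (i : Fin k) (j : Fin l),
      (finSumFinEquiv (Sum.inl i) : Fin (k + l)) < finSumFinEquiv (Sum.inr j) := by
    intro i j
    simp only [finSumFinEquiv_apply_left, finSumFinEquiv_apply_right, Fin.lt_def,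
      Fin.val_castAdd, Fin.val_natAdd]
    omega
  have h2 : ∀ i j : Fin k,
      (finSumFinEquiv (Sum.inl i) : Fin (k + l)) < finSumFinEquiv (Sum.inl j) ↔ i < j := by
    intro i j
    simp only [finSumFinEquiv_apply_left]
    exact Iff.rfl
  have h3 : ∀ i j : Fin l,
      (finSumFinEquiv (Sum.inr i) : Fin (k + l)) < finSumFinEquiv (Sum.inr j) ↔ i < j := by
    intro i j; simp
  simp only [h1, h2, h3, (h1 _ _).not_gt, if_true, if_false, prod_const_one,
    Function.comp_apply, Equiv.symm_apply_apply]
  ring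

lemma splitVandermonde_comp {R : Type*} [CommRing R] {k l : ℕ} (x : Fin k ⊕ Fin l → R)
    (ρ : Perm (Fin k ⊕ Fin l)) :
    splitVandermonde (x ∘ ρ) = ((sign ρ : ℤ) : R) * splitVandermonde x := by
  rw [← det_pow_finSumFinEquiv, ← det_pow_finSumFinEquiv, ← Matrix.det_permute]
  rfl

/-- The Pfaffian of a divided-difference array, with the Pfaffian written as a sum over all
permutations. -/
lemma sum_perm_divided_difference (a f g x : Fin m ⊕ Fin m → K)
    (hx : Function.Injective x) (S : Matrix (Fin m ⊕ Fin m) (Fin m ⊕ Fin m) K)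
    (hS : ∀ i j, i ≠ j → S i j * (x j - x i) = f i * g j - g i * f j) :
    ((m.factorial * (m + 1).factorial : ℕ) : K) *
        (∑ ρ : Perm (Fin m ⊕ Fin m), ((sign ρ : ℤ) : K) *
          ∏ i, ((a (ρ (Sum.inl i)) - a (ρ (Sum.inr i))) * S (ρ (Sum.inl i)) (ρ (Sum.inr i)))) *
        splitVandermonde x =
      2 ^ m * m.factorial * (∏ i : Fin m, ∏ _j ∈ Ioi i, (-1 : K)) * (bialternant f g x).det *
        ∑ ρ : Perm (Fin m ⊕ Fin m), ((sign ρ : ℤ) : K) *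
          ((∏ i, (a (ρ (Sum.inl i)) - a (ρ (Sum.inr i)))) *
            (vandermonde fun i => x (ρ (Sum.inl i))).det *
            (vandermonde fun i => x (ρ (Sum.inr i))).det) := by
  have hsymm : ∀ i j, i ≠ j → S i j = S j i := by
    intro i j hij
    have hne : x j - x i ≠ 0 := sub_ne_zero.2 fun h => hij (hx h).symm
    apply mul_right_cancel₀ hne
    linear_combination hS i j hij + hS j i hij.symm
  set η : K := ∏ i : Fin m, ∏ _j ∈ Ioi i, (-1 : K) with hη
  have hηη : η * η = 1 := by simp only [hη, ← prod_mul_distrib]; simp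
  have hdet : ∀ ρ : Perm (Fin m ⊕ Fin m),
      (Matrix.of fun i j => S (ρ (Sum.inl i)) (ρ (Sum.inr j))).det * splitVandermonde x =
      η * (bialternant f g x).det * ((vandermonde fun i => x (ρ (Sum.inl i))).det *
            (vandermonde fun i => x (ρ (Sum.inr i))).det) := by
    intro ρ
    have h1 := det_divided_difference (f ∘ ρ) (g ∘ ρ) (x ∘ ρ) (hx.comp ρ.injective)
      (Matrix.of fun i j => S (ρ (Sum.inl i)) (ρ (Sum.inr j))) (fun i j => hS _ _ (by simp))
    have h2 := splitVandermonde_comp x ρ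
    rw [det_bialternant_comp, ← hη] at h1
    simp only [splitVandermonde, Function.comp_apply] at h1 h2 ⊢
    have hs : ((sign ρ : ℤ) : K) * ((sign ρ : ℤ) : K) = 1 := by
      rw [← Int.cast_mul, ← Units.val_mul, Int.units_mul_self]; simp
    set D := (Matrix.of fun i j => S (ρ (Sum.inl i)) (ρ (Sum.inr j))).det
    set s := ((sign ρ : ℤ) : K)
    set v1 := (vandermonde fun i => x (ρ (Sum.inl i))).det
    set v2 := (vandermonde fun i => x (ρ (Sum.inr i))).det
    set W := (bialternant f g x).det
    set p := ∏ i, ∏ j, (x (ρ (Sum.inr j)) - x (ρ (Sum.inl i)))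
    set V := (vandermonde fun i => x (Sum.inl i)).det * (vandermonde fun i => x (Sum.inr i)).det *
      ∏ i, ∏ j, (x (Sum.inr j) - x (Sum.inl i))
    linear_combination (-D * V + η * W * v1 * v2) * hs - s * D * h2 - s * η * v1 * v2 * h1 -
      s * v1 * v2 * p * D * hηη
  rw [sum_perm_prod_sub_mul_symm a S hsymm, sum_perm_prod_sub_vandermonde]
  have h2 := sum_perm_prod_mul_det a S
  have h3 := sum_perm_prod_vandermonde a x ∅
  simp only [flipOn_inl, notMem_empty, if_false, card_empty, pow_zero, one_mul,
    Nat.factorial_zero, Nat.sub_zero] at h3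
  set P := ∑ ρ : Perm (Fin m ⊕ Fin m), ((sign ρ : ℤ) : K) *
        ∏ i, (a (ρ (Sum.inl i)) * S (ρ (Sum.inl i)) (ρ (Sum.inr i))) with hP
  have h4 : (m.factorial : K) * P * splitVandermonde x = η * (bialternant f g x).det *
      (((m.factorial * m.factorial : ℕ) : K) * (bialternant a 1 x).det) := by
    rw [← h2, ← h3, sum_mul, mul_sum]
    refine sum_congr rfl fun ρ _ => ?_
    linear_combination ((sign ρ : ℤ) : K) * (∏ i, a (ρ (Sum.inl i))) * hdet ρ
  push_cast at h4 ⊢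
  linear_combination 2 ^ m * ((m + 1).factorial : K) * h4

end CorePfaffian

section GappedAlternant

open Equiv
open Equiv.Perm (sign)
open Matrix (vandermonde)

variable {K : Type*} [Field K]

/-- The exponents `0, …, L - 1` and `κ, …, κ + q - 1`. -/
def gapExp (L q κ : ℕ) : Fin L ⊕ Fin q → ℕ :=
  Sum.elim (fun a => (a : ℕ)) fun b => κ + b

/-- The exponents of `gapExp (L + m) (q + m) κ`, with the new ones listed last. -/
def extGapExp (L q κ m : ℕ) : (Fin L ⊕ Fin q) ⊕ (Fin m ⊕ Fin m) → ℕ :=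
  Sum.elim (gapExp L q κ) (Sum.elim (fun k => L + k) fun k => κ + q + k)

/-- The index of the exponent `gapExp L q κ b + k` in `extGapExp L q κ m`. -/
def gapShift {L q m : ℕ} (k : Fin m) : Fin L ⊕ Fin q → (Fin L ⊕ Fin q) ⊕ (Fin m ⊕ Fin m)
  | Sum.inl a => if h : (a : ℕ) + k < L then Sum.inl (Sum.inl ⟨a + k, h⟩)
      else Sum.inr (Sum.inl ⟨a + k - L, by omega⟩)
  | Sum.inr b => if h : (b : ℕ) + k < q then Sum.inl (Sum.inr ⟨b + k, h⟩)
      else Sum.inr (Sum.inr ⟨b + k - q, by omega⟩)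

lemma extGapExp_gapShift {L q κ m : ℕ} (k : Fin m) (b : Fin L ⊕ Fin q) :
    extGapExp L q κ m (gapShift k b) = gapExp L q κ b + k := by
  rcases b with a | b <;> simp only [gapShift] <;> split_ifs with h <;>
    simp [extGapExp, gapExp] <;> omega

lemma lt_of_gapShift_eq_inr {L q m : ℕ} {k : Fin m} {b : Fin L ⊕ Fin q} {s : Fin m ⊕ Fin m}
    (h : gapShift k b = Sum.inr s) : Sum.elim id id s < k := by
  rcases b with a | b <;> simp only [gapShift] at h <;> split_ifs at h with h' <;>
    simp only [Sum.inr.injEq] at h <;> subst h <;>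
    simp only [Sum.elim_inl, Sum.elim_inr, id, Fin.lt_def] <;> omega

/-- The alternant with variables `y` and exponents `gapExp L q κ`. -/
def gapMatrix {L q : ℕ} (κ : ℕ) (y : Fin L ⊕ Fin q → K) :
    Matrix (Fin L ⊕ Fin q) (Fin L ⊕ Fin q) K :=
  Matrix.of fun a b => y a ^ gapExp L q κ b

/-- The alternant with variables `y, x` and exponents `extGapExp L q κ m`. -/
def extGapMatrix {L q m : ℕ} (κ : ℕ) (y : Fin L ⊕ Fin q → K) (x : Fin m ⊕ Fin m → K) :
    Matrix ((Fin L ⊕ Fin q) ⊕ (Fin m ⊕ Fin m)) ((Fin L ⊕ Fin q) ⊕ (Fin m ⊕ Fin m)) K :=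
  Matrix.of fun a b => Sum.elim y x a ^ extGapExp L q κ m b

/-- The polynomial in `z` with monomials `z ^ e` and `z ^ gapExp L q κ b` that vanishes at
all `y a` and in which `z ^ e` has coefficient `(gapMatrix κ y).det`. -/
noncomputable def gapPoly {L q : ℕ} (κ : ℕ) (y : Fin L ⊕ Fin q → K) (e : ℕ) (z : K) : K :=
  (gapMatrix κ y).det * z ^ e -
    ∑ b, z ^ gapExp L q κ b * ((gapMatrix κ y).adjugate.mulVec fun a => y a ^ e) b

lemma gapPoly_self {L q : ℕ} (κ : ℕ) (y : Fin L ⊕ Fin q → K) (e : ℕ) (a : Fin L ⊕ Fin q) :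
    gapPoly κ y e (y a) = 0 := by
  have h : (gapMatrix κ y).mulVec ((gapMatrix κ y).adjugate.mulVec fun a => y a ^ e) =
      (gapMatrix κ y).det • fun a => y a ^ e := by
    rw [Matrix.mulVec_mulVec, Matrix.mul_adjugate, Matrix.smul_mulVec, Matrix.one_mulVec]
  have := congrFun h a
  simp only [Matrix.mulVec, dotProduct, Pi.smul_apply, smul_eq_mul] at this
  rw [gapPoly, ← this, sub_eq_zero]
  rfl

lemma det_gapMatrix_mul_det_bialternant {L q m : ℕ} (κ : ℕ) (y : Fin L ⊕ Fin q → K)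
    (x : Fin m ⊕ Fin m → K) :
    (gapMatrix κ y).det * (bialternant (fun s => gapPoly κ y L (x s))
        (fun s => gapPoly κ y (κ + q) (x s)) x).det =
      (extGapMatrix κ y x).det * (gapMatrix κ y).det ^ (2 * m) := by
  set c := (gapMatrix κ y).det with hc
  set φ : ℕ → Fin L ⊕ Fin q → K :=
    fun e => (gapMatrix κ y).adjugate.mulVec fun a => y a ^ e with hφ
  set B : Fin m ⊕ Fin m → (Fin L ⊕ Fin q) ⊕ (Fin m ⊕ Fin m) → K :=
    fun t s => (if s = Sum.inr t then c else 0) -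
      ∑ b, if s = gapShift (Sum.elim id id t) b then
        φ (Sum.elim (fun _ => L) (fun _ => κ + q) t) b else 0 with hB
  set B₁ : Matrix (Fin L ⊕ Fin q) (Fin m ⊕ Fin m) K := Matrix.of fun s t => B t (Sum.inl s)
  set B₂ : Matrix (Fin m ⊕ Fin m) (Fin m ⊕ Fin m) K := Matrix.of fun s t => B t (Sum.inr s)
    with hB₂
  have hzero : ∀ s t : Fin m ⊕ Fin m, ¬ Sum.elim id id s < Sum.elim id id t →
      B₂ s t = if s = t then c else 0 := by
    intro s t hst
    simp only [hB₂, hB, Matrix.of_apply, Sum.inr.injEq]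
    rw [sum_eq_zero, sub_zero]
    exact fun b _ => if_neg fun h => hst (lt_of_gapShift_eq_inr h.symm)
  have hdetB : B₂.det = c ^ (2 * m) := by
    have htri : B₂.BlockTriangular (Sum.elim id id) := by
      intro s t hst
      rw [hzero s t hst.not_gt, if_neg]
      rintro rfl
      exact hst.false
    rw [htri.det_fintype, pow_mul]
    trans ∏ _k : Fin m, c ^ 2
    swap
    · simp
    refine prod_congr rfl fun k _ => ?_
    have : B₂.toSquareBlock (Sum.elim id id) k = Matrix.diagonal fun _ => c := by
      ext s t
      rw [Matrix.toSquareBlock_def, Matrix.of_apply,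
        hzero _ _ (by rw [s.2, t.2]; exact lt_irrefl k), Matrix.diagonal_apply]
      simp [Subtype.ext_iff]
    rw [this, Matrix.det_diagonal, prod_const, card_univ]
    congr 1
    have : (univ.filter fun s : Fin m ⊕ Fin m => Sum.elim id id s = k) =
        {Sum.inl k, Sum.inr k} := by
      ext (s | s) <;> simp
    rw [Fintype.card_subtype, this, card_pair Sum.inl_ne_inr]
  have hmul : ∀ (z : K) (t : Fin m ⊕ Fin m), ∑ s, z ^ extGapExp L q κ m s * B t s =
      z ^ ((Sum.elim id id t : Fin m) : ℕ) *
        gapPoly κ y (Sum.elim (fun _ => L) (fun _ => κ + q) t) z := by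
    intro z t
    simp only [hB, mul_sub, sum_sub_distrib, mul_sum, mul_ite, mul_zero]
    rw [sum_comm]
    simp only [sum_ite_eq', mem_univ, if_true, extGapExp_gapShift, gapPoly, mul_sub,
      mul_sum]
    congr 1
    · rcases t with t | t <;> simp [extGapExp, pow_add] <;> ring
    · exact sum_congr rfl fun b _ => by rw [pow_add]; ring
  have hprod : extGapMatrix κ y x * Matrix.fromBlocks 1 B₁ 0 B₂ =
      Matrix.fromBlocks (gapMatrix κ y) 0
        (Matrix.of fun s b => x s ^ gapExp L q κ b)
        (bialternant (fun s => gapPoly κ y L (x s)) (fun s => gapPoly κ y (κ + q) (x s)) x) := by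
    ext r t
    rw [Matrix.mul_apply]
    rcases t with b | t
    · rw [Fintype.sum_sum_type]
      rcases r with r | r <;>
        simp [extGapMatrix, extGapExp, gapMatrix, Matrix.one_apply]
    · have : ∀ s : (Fin L ⊕ Fin q) ⊕ (Fin m ⊕ Fin m),
          Matrix.fromBlocks (1 : Matrix (Fin L ⊕ Fin q) (Fin L ⊕ Fin q) K) B₁ 0 B₂ s (Sum.inr t) =
            B t s := by
        rintro (s | s) <;> rfl
      simp only [this]
      rw [sum_congr rfl fun s _ => by rw [extGapMatrix, Matrix.of_apply], hmul]
      rcases r with r | r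
      · rw [Sum.elim_inl, gapPoly_self, mul_zero]; rfl
      · rcases t with t | t <;> simp [bialternant, mul_comm]
  have := congrArg Matrix.det hprod
  rw [Matrix.det_mul, Matrix.det_fromBlocks_zero₂₁, Matrix.det_fromBlocks_zero₁₂, Matrix.det_one,
    one_mul, hdetB] at this
  exact this.symm

end GappedAlternant

section PfaffianSum

open Equiv
open Equiv.Perm (sign)
open Matrix (vandermonde)

/-- The enumeration of `Fin (2 * m)` by `2 * i` and `2 * i + 1`. -/
noncomputable def interleaveEquiv (m : ℕ) : Fin m ⊕ Fin m ≃ Fin (2 * m) :=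
  Equiv.ofBijective (Sum.elim (fun i => ⟨2 * i, by omega⟩) fun i => ⟨2 * i + 1, by omega⟩) <| by
    rw [Fintype.bijective_iff_injective_and_card]
    refine ⟨?_, by simp [two_mul]⟩
    rintro (i | i) (j | j) h <;> simp [Fin.ext_iff] at h ⊢ <;> omega

/-- The enumeration of `Fin (2 * m)` by `i` and `m + i`. -/
noncomputable def halvesEquiv (m : ℕ) : Fin m ⊕ Fin m ≃ Fin (2 * m) :=
  Equiv.ofBijective (Sum.elim (fun i => ⟨i, by omega⟩) fun i => ⟨m + i, by omega⟩) <| by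
    rw [Fintype.bijective_iff_injective_and_card]
    refine ⟨?_, by simp [two_mul]⟩
    rintro (i | i) (j | j) h <;> simp [Fin.ext_iff] at h ⊢ <;> omega

lemma sign_interleaveEquiv_symm_trans (m : ℕ) :
    sign ((interleaveEquiv m).symm.trans (halvesEquiv m)) =
      ∏ i : Fin m, ∏ _j ∈ Ioi i, -1 := by
  have h (s t : Fin m ⊕ Fin m) :
      (interleaveEquiv m s < interleaveEquiv m t ∧ halvesEquiv m t < halvesEquiv m s) ↔
        ∃ i j, i < j ∧ s = Sum.inr i ∧ t = Sum.inl j := by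
    rcases s with i | i <;> rcases t with j | j <;>
      simp only [interleaveEquiv, halvesEquiv, Equiv.ofBijective_apply, Sum.elim_inl, Sum.elim_inr,
        Fin.lt_def, Sum.inl.injEq, Sum.inr.injEq, reduceCtorEq, false_and, and_false, exists_false,
        iff_false]
    · omega
    · omega
    · refine ⟨fun h => ⟨i, j, by omega, rfl, rfl⟩, ?_⟩
      rintro ⟨_, _, h, rfl, rfl⟩
      omega
    · omega
  rw [sign_symm_trans]
  simp only [h, Fintype.prod_sum_type]
  simp [← filter_lt_eq_Ioi, prod_ite]

variable {R : Type*} [CommRing R]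

lemma sum_perm_comp_equiv {ι α : Type*} [Fintype ι] [DecidableEq ι] [Fintype α] [DecidableEq α]
    (e₁ e₂ : ι ≃ α) (F : (ι → α) → R) :
    ∑ σ : Perm α, ((sign σ : ℤ) : R) * F (σ ∘ e₁) =
      ((sign (e₁.symm.trans e₂) : ℤ) : R) * ∑ ρ : Perm ι, ((sign ρ : ℤ) : R) * F (e₂ ∘ ρ) := by
  rw [← (Equiv.equivCongr e₁ e₂).sum_comp, mul_sum]
  refine sum_congr rfl fun ρ _ => ?_
  have h : Equiv.equivCongr e₁ e₂ ρ = (e₂.symm.trans (ρ.trans e₂)) * (e₁.symm.trans e₂) := by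
    ext; simp
  have h' : ⇑(Equiv.equivCongr e₁ e₂ ρ) ∘ e₁ = e₂ ∘ ρ := by
    ext; simp
  rw [h', h, Perm.sign_mul, show e₂.symm.trans (ρ.trans e₂) = (e₂.symm.trans ρ).trans e₂ from rfl,
    Perm.sign_symm_trans_trans]
  push_cast
  ring

lemma two_pow_mul_factorial_mul_pfaffian {m : ℕ} (M : Matrix (Fin (2 * m)) (Fin (2 * m)) R)
    (hM : ∀ i j, M i j = -M j i) :
    2 ^ m * (m.factorial : R) * pfaffian m M =
      (∏ i : Fin m, ∏ _j ∈ Ioi i, (-1 : R)) * ∑ ρ : Perm (Fin m ⊕ Fin m), ((sign ρ : ℤ) : R) *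
        ∏ i, M (halvesEquiv m (ρ (Sum.inl i))) (halvesEquiv m (ρ (Sum.inr i))) := by
  have h := sum_perm_comp_equiv (interleaveEquiv m) (halvesEquiv m)
    fun s => ∏ i, M (s (Sum.inl i)) (s (Sum.inr i))
  rw [sign_interleaveEquiv_symm_trans] at h
  push_cast at h
  exact (sum_perm_pairs (interleaveEquiv m) M hM).symm.trans h

lemma vanderm_eq_det_vandermonde {K : Type*} [Field K] {m : ℕ} (t : Fin m → K) :
    vanderm t = (∏ i : Fin m, ∏ _j ∈ Ioi i, (-1 : K)) * (vandermonde t).det := by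
  rw [vanderm, Matrix.det_vandermonde, ← prod_mul_distrib]
  refine prod_congr rfl fun i _ => ?_
  rw [← prod_mul_distrib, ← filter_lt_eq_Ioi, prod_filter]
  exact prod_congr rfl fun j _ => by split_ifs <;> ring

lemma pfaffian_divided_difference {K : Type*} [Field K] [CharZero K] {m : ℕ}
    (a f g x : Fin (2 * m) → K) (hx : Function.Injective x)
    (S : Matrix (Fin (2 * m)) (Fin (2 * m)) K)
    (hS : ∀ i j, i ≠ j → S i j * (x j - x i) = f i * g j - g i * f j) :
    ((m.factorial * (m + 1).factorial : ℕ) : K) *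
        pfaffian m (Matrix.of fun i j => (a i - a j) * S i j) *
        splitVandermonde (x ∘ halvesEquiv m) =
      (bialternant (f ∘ halvesEquiv m) (g ∘ halvesEquiv m) (x ∘ halvesEquiv m)).det *
        ∑ σ : Perm (Fin (2 * m)), ((sign σ : ℤ) : K) *
          ((∏ i : Fin m, (a (σ ⟨i.val, by omega⟩) - a (σ ⟨m + i.val, by omega⟩))) *
            vanderm (fun i : Fin m => x (σ ⟨i.val, by omega⟩)) *
            vanderm (fun i : Fin m => x (σ ⟨m + i.val, by omega⟩))) := by
  set e := halvesEquiv m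
  set η : K := ∏ i : Fin m, ∏ _j ∈ Ioi i, (-1 : K) with hη
  have hηη : η * η = 1 := by simp only [hη, ← prod_mul_distrib]; simp
  have h1 := sum_perm_divided_difference (a ∘ e) (f ∘ e) (g ∘ e) (x ∘ e)
    (hx.comp e.injective) (Matrix.of fun i j => S (e i) (e j))
    fun i j hij => hS _ _ (e.injective.ne hij)
  have hsymm : ∀ i j, i ≠ j → S i j = S j i := by
    intro i j hij
    have hne : x j - x i ≠ 0 := sub_ne_zero.2 fun h => hij (hx h).symm
    apply mul_right_cancel₀ hne
    linear_combination hS i j hij + hS j i hij.symm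
  have h2 := two_pow_mul_factorial_mul_pfaffian
    (Matrix.of fun i j => (a i - a j) * S i j) (by
      intro i j
      rcases eq_or_ne i j with rfl | hij
      · simp
      · simp only [Matrix.of_apply, hsymm i j hij]
        ring)
  have h3 : ∑ σ : Perm (Fin (2 * m)), ((sign σ : ℤ) : K) *
          ((∏ i : Fin m, (a (σ ⟨i.val, by omega⟩) - a (σ ⟨m + i.val, by omega⟩))) *
            vanderm (fun i : Fin m => x (σ ⟨i.val, by omega⟩)) *
            vanderm (fun i : Fin m => x (σ ⟨m + i.val, by omega⟩))) = _ :=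
    sum_perm_comp_equiv e e fun s => (∏ i, (a (s (Sum.inl i)) - a (s (Sum.inr i)))) *
      vanderm (fun i => x (s (Sum.inl i))) * vanderm fun i => x (s (Sum.inr i))
  have h4 : ∑ ρ : Perm (Fin m ⊕ Fin m), ((sign ρ : ℤ) : K) *
      ((∏ i, (a (e (ρ (Sum.inl i))) - a (e (ρ (Sum.inr i))))) *
        vanderm (fun i => x (e (ρ (Sum.inl i)))) * vanderm fun i => x (e (ρ (Sum.inr i)))) =
      ∑ ρ : Perm (Fin m ⊕ Fin m), ((sign ρ : ℤ) : K) *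
      ((∏ i, (a (e (ρ (Sum.inl i))) - a (e (ρ (Sum.inr i))))) *
        (vandermonde fun i => x (e (ρ (Sum.inl i)))).det *
        (vandermonde fun i => x (e (ρ (Sum.inr i)))).det) := by
    refine sum_congr rfl fun ρ _ => ?_
    rw [vanderm_eq_det_vandermonde, vanderm_eq_det_vandermonde, ← hη]
    linear_combination ((sign ρ : ℤ) : K) *
      (∏ i, (a (e (ρ (Sum.inl i))) - a (e (ρ (Sum.inr i))))) *
        (vandermonde fun i => x (e (ρ (Sum.inl i)))).det *
        (vandermonde fun i => x (e (ρ (Sum.inr i)))).det * hηη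
  rw [h3]
  simp only [Function.comp_apply, Matrix.of_apply, Equiv.symm_trans_self, Perm.sign_refl,
    Units.val_one, Int.cast_one, one_mul] at h1 h2 h3 ⊢
  rw [h4]
  have h5 : (2 ^ m * m.factorial : K) ≠ 0 :=
    mul_ne_zero (pow_ne_zero _ two_ne_zero) (Nat.cast_ne_zero.2 m.factorial_ne_zero)
  apply mul_left_cancel₀ h5
  simp only [Nat.cast_mul] at h1 ⊢
  linear_combination (m.factorial * (m + 1).factorial : K) * splitVandermonde (x ∘ e) * h2 +
    η * h1 + (2 ^ m * m.factorial : K) * (bialternant (f ∘ e) (g ∘ e) (x ∘ e)).det *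
      (∑ ρ : Perm (Fin m ⊕ Fin m), ((sign ρ : ℤ) : K) *
      ((∏ i, (a (e (ρ (Sum.inl i))) - a (e (ρ (Sum.inr i))))) *
        (vandermonde fun i => x (e (ρ (Sum.inl i)))).det *
        (vandermonde fun i => x (e (ρ (Sum.inr i)))).det)) * hηη

end PfaffianSum

section RectangularSchur

open Equiv
open Equiv.Perm (sign)
open Matrix (vandermonde)

lemma det_submatrix_equiv_equiv {R ι : Type*} [CommRing R] [Fintype ι] [DecidableEq ι] {n : ℕ}
    (M : Matrix (Fin n) (Fin n) R) (ψ χ : ι ≃ Fin n) :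
    (M.submatrix ψ χ).det = ((sign (ψ.symm.trans χ) : ℤ) : R) * M.det := by
  have h : M.submatrix ψ χ = (M.submatrix id (ψ.symm.trans χ)).submatrix ψ ψ := by
    ext i j; simp
  rw [h, Matrix.det_submatrix_equiv_self, Matrix.det_permute']

/-- The order on rows used by `extGapMatrix`. -/
def extRowEquiv (L q m : ℕ) :
    (Fin L ⊕ Fin q) ⊕ (Fin m ⊕ Fin m) ≃ Fin (L + q + (m + m)) :=
  (Equiv.sumCongr finSumFinEquiv finSumFinEquiv).trans finSumFinEquiv

/-- The order on columns that sorts the exponents of `extGapMatrix`. -/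
def extColEquiv (L q m : ℕ) :
    (Fin L ⊕ Fin q) ⊕ (Fin m ⊕ Fin m) ≃ Fin (L + q + (m + m)) :=
  (Equiv.sumSumSumComm _ _ _ _).trans <|
    (Equiv.sumCongr finSumFinEquiv finSumFinEquiv).trans <|
      finSumFinEquiv.trans (finCongr (by omega))

lemma val_extRowEquiv (L q m : ℕ) (s : (Fin L ⊕ Fin q) ⊕ (Fin m ⊕ Fin m)) :
    (extRowEquiv L q m s : ℕ) =
      Sum.elim (Sum.elim (fun a : Fin L => (a : ℕ)) fun b : Fin q => L + b)
      (Sum.elim (fun k : Fin m => L + q + k) fun k : Fin m => L + q + (m + k)) s := by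
  rcases s with (i | i) | (i | i) <;> simp [extRowEquiv, add_comm m]

lemma val_extColEquiv (L q m : ℕ) (s : (Fin L ⊕ Fin q) ⊕ (Fin m ⊕ Fin m)) :
    (extColEquiv L q m s : ℕ) =
      Sum.elim (Sum.elim (fun a : Fin L => (a : ℕ)) fun b : Fin q => L + m + b)
      (Sum.elim (fun k : Fin m => L + k) fun k : Fin m => L + m + (q + k)) s := by
  rcases s with (i | i) | (i | i) <;> simp [extColEquiv]

lemma sign_extRowEquiv_symm_trans (L q m : ℕ) :
    sign ((extRowEquiv L q m).symm.trans (extColEquiv L q m)) = (-1) ^ (q * m) := by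
  have h (s t) : (extRowEquiv L q m s < extRowEquiv L q m t ∧
      extColEquiv L q m t < extColEquiv L q m s) ↔
        ∃ i j, s = Sum.inl (Sum.inr i) ∧ t = Sum.inr (Sum.inl j) := by
    rcases s with (i | i) | (i | i) <;> rcases t with (j | j) | (j | j) <;>
      simp only [Fin.lt_def, val_extRowEquiv, val_extColEquiv, Sum.elim_inl, Sum.elim_inr,
        Sum.inl.injEq, Sum.inr.injEq, reduceCtorEq, false_and, and_false, exists_false, iff_false,
        exists_and_left, exists_eq_left', exists_eq', iff_true] <;> omega
  rw [sign_symm_trans]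
  simp only [h, Fintype.prod_sum_type]
  simp [← pow_mul, mul_comm]

variable {K : Type*} [Field K]

lemma det_vandermonde_eq_splitVandermonde {k l : ℕ} (t : Fin (k + l) → K) :
    (vandermonde t).det = splitVandermonde (t ∘ finSumFinEquiv) := by
  rw [← det_pow_finSumFinEquiv, ← Matrix.det_submatrix_equiv_self finSumFinEquiv]
  rfl

lemma schur_mul_splitVandermonde {L q r : ℕ} (y : Fin (L + q) → K)
    (hy : Function.Injective y) :
    schur (padIncr q (L + q) fun _ => r) y * splitVandermonde (y ∘ finSumFinEquiv) =
      (gapMatrix (L + r) (y ∘ finSumFinEquiv)).det := by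
  rw [← det_vandermonde_eq_splitVandermonde, schur]
  refine (div_mul_cancel₀ _ (Matrix.det_vandermonde_ne_zero_iff.2 hy)).trans ?_
  rw [← Matrix.det_submatrix_equiv_self finSumFinEquiv]
  congr 1
  ext i (j | j) <;>
    simp only [Matrix.submatrix_apply, Matrix.of_apply, gapMatrix, gapExp, padIncr,
      Function.comp_apply, finSumFinEquiv_apply_left, finSumFinEquiv_apply_right,
      Fin.val_castAdd, Fin.val_natAdd, Sum.elim_inl, Sum.elim_inr]
  · rw [dif_neg (by omega), zero_add]
  · rw [dif_pos (by omega)]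
    congr 1
    omega

lemma det_vandermonde_extRowEquiv {L q m : ℕ} (t : Fin (L + q + (m + m)) → K)
    (y : Fin L ⊕ Fin q → K) (x : Fin m ⊕ Fin m → K)
    (hyx : ∀ s, t (extRowEquiv L q m s) = Sum.elim y x s) :
    (vandermonde t).det =
      splitVandermonde y * splitVandermonde x * ∏ s, ∏ a, (x s - y a) := by
  have hy : (fun i => t (finSumFinEquiv (Sum.inl i))) ∘ finSumFinEquiv = y :=
    funext fun s => hyx (Sum.inl s)
  have hx : (fun i => t (finSumFinEquiv (Sum.inr i))) ∘ finSumFinEquiv = x :=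
    funext fun s => hyx (Sum.inr s)
  rw [det_vandermonde_eq_splitVandermonde, splitVandermonde]
  simp only [Function.comp_apply]
  rw [det_vandermonde_eq_splitVandermonde, det_vandermonde_eq_splitVandermonde, hy, hx, prod_comm,
    ← finSumFinEquiv.prod_comp]
  congr 1
  refine prod_congr rfl fun s _ => ?_
  rw [← finSumFinEquiv.prod_comp]
  exact prod_congr rfl fun a _ => congrArg₂ _ (hyx (Sum.inr s)) (hyx (Sum.inl a))

lemma schur_mul_splitVandermonde_ext {L q m n r R : ℕ} (hn : L + q + (m + m) = n)
    (hR : R + m = r) (t : Fin n → K) (ht : Function.Injective t)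
    (y : Fin L ⊕ Fin q → K) (x : Fin m ⊕ Fin m → K)
    (hyx : ∀ s, t (Fin.cast hn (extRowEquiv L q m s)) = Sum.elim y x s) :
    schur (padIncr (q + m) n fun _ => R) t *
        (splitVandermonde y * splitVandermonde x * ∏ s, ∏ a, (x s - y a)) =
      (-1) ^ (q * m) * (extGapMatrix (L + r) y x).det := by
  subst hn hR
  simp only [Fin.cast_refl, id] at hyx
  rw [← det_vandermonde_extRowEquiv t y x hyx, schur]
  refine (div_mul_cancel₀ _ (Matrix.det_vandermonde_ne_zero_iff.2 ht)).trans ?_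
  have h := det_submatrix_equiv_equiv (Matrix.of fun i j : Fin (L + q + (m + m)) =>
    t i ^ (padIncr (q + m) (L + q + (m + m)) (fun _ => R) j + (j : ℕ)))
    (extRowEquiv L q m) (extColEquiv L q m)
  rw [sign_extRowEquiv_symm_trans] at h
  have h' : (Matrix.of fun i j : Fin (L + q + (m + m)) =>
      t i ^ (padIncr (q + m) (L + q + (m + m)) (fun _ => R) j + (j : ℕ))).submatrix
      (extRowEquiv L q m) (extColEquiv L q m) = extGapMatrix (L + (R + m)) y x := by
    ext i j
    simp only [Matrix.submatrix_apply, Matrix.of_apply, extGapMatrix, hyx]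
    congr 1
    rcases j with (j | j) | (j | j) <;>
      simp only [val_extColEquiv, extGapExp, gapExp, padIncr, Sum.elim_inl, Sum.elim_inr] <;>
      split_ifs <;> omega
  rw [h'] at h
  rw [h, ← mul_assoc]
  push_cast
  rw [← mul_pow]
  simp

lemma det_bialternant_scale {m : ℕ} (f g x w : Fin m ⊕ Fin m → K) (u : K) :
    (bialternant (fun s => u * w s * f s) (fun s => w s * g s) x).det =
      u ^ m * (∏ s, w s) * (bialternant f g x).det := by
  have h : bialternant (fun s => u * w s * f s) (fun s => w s * g s) x =
      Matrix.diagonal w * bialternant f g x *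
        Matrix.diagonal (Sum.elim (fun _ : Fin m => u) fun _ : Fin m => 1) := by
    ext s (t | t) <;> simp [bialternant] <;> ring
  rw [h, Matrix.det_mul, Matrix.det_mul, Matrix.det_diagonal, Matrix.det_diagonal]
  have : ∏ i, Sum.elim (fun _ : Fin m => u) (fun _ : Fin m => 1) i = u ^ m := by
    simp [Fintype.prod_sum_type]
  rw [this]
  ring

end RectangularSchur

section PfaffianFactorization

open Equiv
open Equiv.Perm (sign)

variable {K : Type*}

/-- The list `y, x i, x j`. -/
def appendPair {N n : ℕ} (y : Fin N → K) (x : Fin n → K) (i j : Fin n) (s : Fin (N + 2)) : K :=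
  if h : (s : ℕ) < N then y ⟨s, h⟩ else if (s : ℕ) = N then x i else x j

/-- The list `y, x`. -/
def appendAll {N n : ℕ} (y : Fin N → K) (x : Fin n → K) (s : Fin (N + n)) : K :=
  if h : (s : ℕ) < N then y ⟨s, h⟩ else x ⟨(s : ℕ) - N, by omega⟩

lemma appendPair_of_eq {N n : ℕ} {y : Fin N → K} {x : Fin n → K} {i j : Fin n} {s : Fin (N + 2)}
    (hs : (s : ℕ) = N) : appendPair y x i j s = x i := by
  simp [appendPair, hs]

lemma appendPair_of_eq_add_one {N n : ℕ} {y : Fin N → K} {x : Fin n → K} {i j : Fin n}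
    {s : Fin (N + 2)} (hs : (s : ℕ) = N + 1) : appendPair y x i j s = x j := by
  simp [appendPair, hs]

lemma appendAll_injective {N n : ℕ} {y : Fin N → K} {x : Fin n → K}
    (h : Function.Injective (Sum.elim y x)) : Function.Injective (appendAll y x) := by
  intro s t hst
  simp only [appendAll] at hst
  split_ifs at hst with h1 h2 h2
  · simpa [Fin.ext_iff] using @h (Sum.inl ⟨s, h1⟩) (Sum.inl ⟨t, h2⟩) hst
  · simpa using @h (Sum.inl ⟨s, h1⟩) (Sum.inr ⟨t - N, by omega⟩) hst
  · simpa using @h (Sum.inr ⟨s - N, by omega⟩) (Sum.inl ⟨t, h2⟩) hst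
  · have := @h (Sum.inr ⟨s - N, by omega⟩) (Sum.inr ⟨t - N, by omega⟩) hst
    simp only [Sum.inr.injEq, Fin.mk.injEq] at this
    omega

lemma appendPair_injective {N n : ℕ} {y : Fin N → K} {x : Fin n → K}
    (h : Function.Injective (Sum.elim y x)) {i j : Fin n} (hij : i ≠ j) :
    Function.Injective (appendPair y x i j) := by
  intro s t hst
  have hxy : ∀ a b, y a ≠ x b := fun a b hab => by simpa using @h (Sum.inl a) (Sum.inr b) hab
  have hy : Function.Injective y := h.comp Sum.inl_injective
  have hx : Function.Injective x := h.comp Sum.inr_injective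
  simp only [appendPair] at hst
  split_ifs at hst with h1 h2 h3 h4 h5 h6 h7 h8
  all_goals first
    | exact absurd hst (hxy _ _)
    | exact absurd hst.symm (hxy _ _)
    | exact absurd (hx hst) hij
    | exact absurd (hx hst).symm hij
    | skip
  · simpa [Fin.ext_iff] using hy hst
  all_goals omega

variable [Field K]

/-- Each Schur entry is a divided difference of the polynomials `gapPoly`. -/
lemma schur_appendPair {L q r n : ℕ} (y : Fin (L + q) → K) (x : Fin n → K)
    (Y : Fin L ⊕ Fin q → K) (hY : Y = y ∘ finSumFinEquiv)
    (h : Function.Injective (Sum.elim y x))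
    (hc : (gapMatrix (L + (r + 1)) Y).det ≠ 0) (i j : Fin n) (hij : i ≠ j) :
    schur (padIncr (q + 1) (L + q + 2) fun _ => r) (appendPair y x i j) *
        ((gapMatrix (L + (r + 1)) Y).det *
          splitVandermonde Y * (x j - x i) *
          ((∏ a, (x i - Y a)) * ∏ a, (x j - Y a))) =
      (-1) ^ q *
        (gapPoly (L + (r + 1)) Y L (x i) *
            gapPoly (L + (r + 1)) Y (L + (r + 1) + q) (x j) -
          gapPoly (L + (r + 1)) Y (L + (r + 1) + q) (x i) *
            gapPoly (L + (r + 1)) Y L (x j)) := by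
  set X : Fin 1 ⊕ Fin 1 → K := Sum.elim (fun _ => x i) fun _ => x j with hX
  have h1 := schur_mul_splitVandermonde_ext (m := 1) (n := L + q + 2) rfl rfl
    (R := r) (appendPair y x i j) (appendPair_injective h hij) Y X (by
      intro s
      rcases s with s | (s | s)
      · simp [appendPair, extRowEquiv, hY]
      · obtain rfl := Subsingleton.elim s 0
        exact appendPair_of_eq (val_extRowEquiv L q 1 _)
      · obtain rfl := Subsingleton.elim s 0
        exact appendPair_of_eq_add_one (val_extRowEquiv L q 1 _))
  have h2 := det_gapMatrix_mul_det_bialternant (m := 1) (L + (r + 1)) Y X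
  have h3 : (bialternant (fun s => gapPoly (L + (r + 1)) Y L (X s))
      (fun s => gapPoly (L + (r + 1)) Y (L + (r + 1) + q) (X s)) X).det =
      gapPoly (L + (r + 1)) Y L (x i) * gapPoly (L + (r + 1)) Y (L + (r + 1) + q) (x j) -
      gapPoly (L + (r + 1)) Y (L + (r + 1) + q) (x i) * gapPoly (L + (r + 1)) Y L (x j) := by
    rw [← Matrix.det_submatrix_equiv_self (finSumFinEquiv (m := 1) (n := 1)).symm,
      Matrix.det_fin_two]
    simp [bialternant, hX, show (finSumFinEquiv (m := 1) (n := 1)).symm 0 = Sum.inl 0 from rfl,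
      show (finSumFinEquiv (m := 1) (n := 1)).symm 1 = Sum.inr 0 from rfl]
  have h4 : splitVandermonde X = x j - x i := by
    simp [splitVandermonde, hX]
  have h5 : ∏ s, ∏ a, (X s - Y a) = (∏ a, (x i - Y a)) * ∏ a, (x j - Y a) := by
    simp [Fintype.prod_sum_type, hX]
  rw [h3] at h2
  rw [h4, h5, mul_one] at h1
  apply mul_left_cancel₀ hc
  linear_combination (gapMatrix (L + (r + 1)) Y).det ^ 2 * h1 - (-1) ^ q * h2

lemma pfaffian_rectangle_schur_of_injective [CharZero K] {L q m r R : ℕ}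
    (hR : R + m = r + 1) (hm : 1 ≤ m)
    (a x : Fin (2 * m) → K) (y : Fin (L + q) → K) (h : Function.Injective (Sum.elim y x))
    (hc : (gapMatrix (L + (r + 1)) (y ∘ finSumFinEquiv)).det ≠ 0) :
    ((m.factorial * (m + 1).factorial : ℕ) : K) *
        pfaffian m (Matrix.of fun i j => (a i - a j) *
          schur (padIncr (q + 1) (L + q + 2) fun _ => r) (appendPair y x i j)) =
      schur (padIncr q (L + q) fun _ => r + 1) y ^ (m - 1) *
        schur (padIncr (q + m) (L + q + 2 * m) fun _ => R) (appendAll y x) *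
        ∑ σ : Perm (Fin (2 * m)), ((sign σ : ℤ) : K) *
          ((∏ i : Fin m, (a (σ ⟨i.val, by omega⟩) - a (σ ⟨m + i.val, by omega⟩))) *
            vanderm (fun i : Fin m => x (σ ⟨i.val, by omega⟩)) *
            vanderm (fun i : Fin m => x (σ ⟨m + i.val, by omega⟩))) := by
  have hy : Function.Injective y := h.comp Sum.inl_injective
  have hx : Function.Injective x := h.comp Sum.inr_injective
  have hxy : ∀ b s, x b - y s ≠ 0 := fun b s hbs => by
    simpa using @h (Sum.inr b) (Sum.inl s) (sub_eq_zero.1 hbs)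
  set Y := y ∘ finSumFinEquiv with hY
  set X := x ∘ halvesEquiv m with hX
  set c := (gapMatrix (L + (r + 1)) Y).det
  set w : Fin (2 * m) → K := fun i => (∏ s, (x i - Y s))⁻¹ with hw
  have hw0 : ∀ i, ∏ s, (x i - Y s) ≠ 0 := fun i => prod_ne_zero_iff.2 fun s _ => hxy _ _
  have hV : splitVandermonde Y ≠ 0 := by
    rw [hY, ← det_vandermonde_eq_splitVandermonde]
    exact Matrix.det_vandermonde_ne_zero_iff.2 hy
  have hVX : splitVandermonde X ≠ 0 := by
    rw [← det_pow_finSumFinEquiv, ← Matrix.det_submatrix_equiv_self finSumFinEquiv.symm]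
    have := Matrix.det_vandermonde_ne_zero_iff.2
      ((hx.comp (halvesEquiv m).injective).comp (finSumFinEquiv (m := m) (n := m)).symm.injective)
    convert this using 2
    ext i j
    simp [Matrix.vandermonde_apply, hX]
  set u : K := (-1) ^ q / (c * splitVandermonde Y) with hu
  set f : Fin (2 * m) → K := fun i => gapPoly (L + (r + 1)) Y L (x i) with hf
  set g : Fin (2 * m) → K := fun i => gapPoly (L + (r + 1)) Y (L + (r + 1) + q) (x i) with hg
  have h1 := pfaffian_divided_difference a (fun i => u * w i * f i) (fun i => w i * g i) x hx
    (Matrix.of fun i j => schur (padIncr (q + 1) (L + q + 2) fun _ => r) (appendPair y x i j)) (by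
      intro i j hij
      have := schur_appendPair y x Y hY h hc i j hij
      have hi := hw0 i
      have hj := hw0 j
      simp only [Matrix.of_apply, hw, hu, hf, hg]
      field_simp
      linear_combination this)
  have h2 := det_bialternant_scale (f ∘ halvesEquiv m) (g ∘ halvesEquiv m) X
    (w ∘ halvesEquiv m) u
  have h3 := det_gapMatrix_mul_det_bialternant (L + (r + 1)) Y X
  have h4 := schur_mul_splitVandermonde_ext (m := m) (n := L + q + 2 * m) (by ring) hR
    (appendAll y x) (appendAll_injective h) Y X (by
      intro s
      rcases s with s | s
      · simp [appendAll, extRowEquiv, hY]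
      · rw [appendAll, dif_neg (by rcases s with s | s <;> simp [val_extRowEquiv])]
        simp only [hX, Function.comp_apply, Sum.elim_inr]
        congr 1
        rcases s with s | s <;> simp [val_extRowEquiv, halvesEquiv])
  have h5 := schur_mul_splitVandermonde (r := r + 1) y hy
  rw [← hY] at h5
  change _ = c at h5
  have hW : ∏ s, ∏ a, (X s - Y a) ≠ 0 := prod_ne_zero_iff.2 fun s _ => hw0 _
  have h6 : ∏ s, (w ∘ halvesEquiv m) s = (∏ s, ∏ a, (X s - Y a))⁻¹ := by
    rw [← prod_inv_distrib]
    rfl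
  have h7 : (bialternant ((fun i => u * w i * f i) ∘ halvesEquiv m)
      ((fun i => w i * g i) ∘ halvesEquiv m) X).det =
      schur (padIncr q (L + q) fun _ => r + 1) y ^ (m - 1) *
        schur (padIncr (q + m) (L + q + 2 * m) fun _ => R) (appendAll y x) *
        splitVandermonde X := by
    refine h2.trans ?_
    rw [h6, eq_div_of_mul_eq hV h5, eq_div_of_mul_eq (mul_ne_zero (mul_ne_zero hV hVX) hW) h4]
    have h8 : (bialternant (f ∘ halvesEquiv m) (g ∘ halvesEquiv m) X).det =
        (extGapMatrix (L + (r + 1)) Y X).det * c ^ (2 * m) / c := by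
      rw [eq_div_iff hc, ← h3, mul_comm]
      rfl
    rw [h8, hu]
    obtain ⟨k, rfl⟩ := Nat.exists_eq_add_of_le' hm
    simp only [Nat.add_sub_cancel, div_pow, mul_pow, ← pow_mul]
    field_simp
    ring
  apply mul_right_cancel₀ hVX
  simp only [Matrix.of_apply] at h1
  rw [h7] at h1
  linear_combination h1

end PfaffianFactorization

section RationalFunctions

instance (N n : ℕ) : CharZero (RatFunc16 N n) :=
  charZero_of_injective_algebraMap
    (IsFractionRing.injective (MvPolynomial (Fin n ⊕ Fin N ⊕ Fin n) ℚ) (RatFunc16 N n))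

lemma sumElim_Y16_X16_injective (N n : ℕ) :
    Function.Injective (Sum.elim (Y16 N n) (X16 N n)) := by
  have h : Sum.elim (Y16 N n) (X16 N n) = fun s =>
      algebraMap (MvPolynomial (Fin n ⊕ Fin N ⊕ Fin n) ℚ) (RatFunc16 N n)
        (MvPolynomial.X (Sum.inr s)) := by
    ext (s | s) <;> rfl
  rw [h]
  exact (IsFractionRing.injective _ _).comp
    ((MvPolynomial.X_injective).comp Sum.inr_injective)

lemma gapExp_injective {L q κ : ℕ} (h : L ≤ κ) : Function.Injective (gapExp L q κ) := by
  rintro (a | a) (b | b) hab <;> simp only [gapExp, Sum.elim_inl, Sum.elim_inr] at hab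
  · rw [Fin.ext hab]
  · omega
  · omega
  · rw [Fin.ext (Nat.add_left_cancel hab)]

lemma det_gapMatrix_Y16_ne_zero {L q κ n : ℕ} (h : L ≤ κ) :
    (gapMatrix κ (Y16 (L + q) n ∘ finSumFinEquiv)).det ≠ 0 := by
  set P := MvPolynomial (Fin n ⊕ Fin (L + q) ⊕ Fin n) ℚ
  set D : P := (Matrix.of fun s t : Fin L ⊕ Fin q =>
    (MvPolynomial.X (Sum.inr (Sum.inl (finSumFinEquiv s))) : P) ^ gapExp L q κ t).det with hD
  have h1 : (gapMatrix κ (Y16 (L + q) n ∘ finSumFinEquiv)).det =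
      algebraMap P (RatFunc16 (L + q) n) D := by
    rw [hD, RingHom.map_det]
    congr 1
    ext s t
    simp [gapMatrix, Y16]
    rfl
  rw [h1, Ne, IsFractionRing.to_map_eq_zero_iff]
  intro h0
  let v : Fin n ⊕ Fin (L + q) ⊕ Fin n → ℚ :=
    Sum.elim 0 (Sum.elim (fun i => 2 ^ (i : ℕ)) 0)
  have h2 := congrArg (MvPolynomial.eval v) h0
  rw [hD, RingHom.map_det, map_zero, ← Matrix.det_transpose,
    ← Matrix.det_submatrix_equiv_self finSumFinEquiv.symm] at h2
  refine Matrix.det_vandermonde_ne_zero_iff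
    (v := fun t : Fin (L + q) => (2 : ℚ) ^ gapExp L q κ (finSumFinEquiv.symm t)) |>.2 ?_ ?_
  · exact (pow_right_injective₀ (by norm_num) (by norm_num)).comp
      ((gapExp_injective h).comp finSumFinEquiv.symm.injective)
  · convert h2 using 2
    ext i j
    simp [Matrix.vandermonde_apply, v, ← pow_mul, mul_comm]

end RationalFunctions

/-- Factorization of the Pfaffian with rectangular-partition Schur function entries:
`m!·(m+1)!·Pf( (aᵢ-aⱼ)·s_{r^p}(y, xᵢ, xⱼ) )
  = (s_{(r+1)^{p-1}}(y))^{m-1} · s_{(r-m+1)^{p+m-1}}(y, x₁,…,x_n) ·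
    ∑_{σ∈S_n} sgn(σ) ∏ᵢ (a_{σ(i)} - a_{σ(m+i)}) · Δ(x_{σ(1)},…,x_{σ(m)})·Δ(x_{σ(m+1)},…,x_{σ(n)})`. -/
theorem pfaffian_rectangle_schur (N m p r : ℕ) (hm : 1 ≤ m) (hp : 1 ≤ p)
    (hpN : p ≤ N + 1) (hr : m - 1 ≤ r) :
    ((Nat.factorial m * Nat.factorial (m + 1) : ℕ) : RatFunc16 N (2 * m)) *
        pfaffian m (Matrix.of fun i j : Fin (2 * m) =>
          (A16 N (2 * m) i - A16 N (2 * m) j) *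
            schur (padIncr p (N + 2) (fun _ => r))
              (fun q : Fin (N + 2) =>
                if h : (q : ℕ) < N then Y16 N (2 * m) ⟨q, h⟩
                else if (q : ℕ) = N then X16 N (2 * m) i else X16 N (2 * m) j))
      = schur (padIncr (p - 1) N (fun _ => r + 1)) (Y16 N (2 * m)) ^ (m - 1) *
          schur (padIncr (p + m - 1) (N + 2 * m) (fun _ => r + 1 - m))
            (fun q : Fin (N + 2 * m) =>
              if h : (q : ℕ) < N then Y16 N (2 * m) ⟨q, h⟩
              else X16 N (2 * m) ⟨(q : ℕ) - N, by omega⟩) *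
          ∑ σ : Equiv.Perm (Fin (2 * m)),
            ((Equiv.Perm.sign σ : ℤ) : RatFunc16 N (2 * m)) *
              ((∏ i : Fin m,
                  (A16 N (2 * m) (σ ⟨i.val, by omega⟩) -
                    A16 N (2 * m) (σ ⟨m + i.val, by omega⟩))) *
                vanderm (fun i : Fin m => X16 N (2 * m) (σ ⟨i.val, by omega⟩)) *
                vanderm (fun i : Fin m => X16 N (2 * m) (σ ⟨m + i.val, by omega⟩))) := by
  obtain ⟨q, rfl⟩ := Nat.exists_eq_add_of_le' hp
  obtain ⟨L, rfl⟩ := Nat.exists_eq_add_of_le' (Nat.le_of_add_le_add_right hpN)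
  rw [Nat.add_sub_cancel, Nat.succ_add_sub_one]
  exact pfaffian_rectangle_schur_of_injective (by omega) hm (A16 (L + q) (2 * m)) _ _
    (sumElim_Y16_X16_injective _ _) (det_gapMatrix_Y16_ne_zero (by omega))
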